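/- Let e ∈ ℝ with |e| < 1. Define x̃(θ) = −c(θ)(1 + 1/ρ(θ)) = −cos θ (2 + e cos θ) and z̃(θ) = s(θ) = ρ(θ) sin θ. Then for all θ ∈ ℝ: x̃′(θ) = 2s(θ), z̃′(θ) = s′(θ) = cos θ + e cos 2θ, and the pair (x̃, z̃) satisfies the in-plane Tschauner–Hempel system x̃″(θ) = 2 z̃′(θ) and z̃″(θ) = 3 z̃(θ)/ρ(θ) − 2 x̃′(θ). -/

import Mathlib

noncomputable section

/-- `ρ(θ) = 1 + e cos θ`. -/
def ρ (e θ : ℝ) : ℝ := 1 + e * Real.cos θ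

/-- `s(θ) = ρ(θ) sin θ`. -/
def s (e θ : ℝ) : ℝ := ρ e θ * Real.sin θ

/-- `s′(θ) = cos θ + e cos 2θ`. -/
def s' (e θ : ℝ) : ℝ := Real.cos θ + e * Real.cos (2 * θ)

/-- Second column of the fundamental matrix: `x̃(θ) = −c(θ)(1 + 1/ρ(θ))`. -/
def xt (e θ : ℝ) : ℝ := -(ρ e θ * Real.cos θ) * (1 + 1 / ρ e θ)

/-- Second column of the fundamental matrix: `z̃(θ) = s(θ)`. -/
def zt (e θ : ℝ) : ℝ := ρ e θ * Real.sin θ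

theorem ρ_pos {e : ℝ} (he : |e| < 1) (θ : ℝ) : 0 < ρ e θ := by
  have h : |e * Real.cos θ| < 1 := by
    rw [abs_mul]
    exact (mul_le_of_le_one_right (abs_nonneg e) (Real.abs_cos_le_one θ)).trans_lt he
  unfold ρ
  linarith [(abs_lt.mp h).1]

theorem xt_eq {e : ℝ} (he : |e| < 1) : xt e = fun θ => -Real.cos θ * (2 + e * Real.cos θ) := by
  funext θ
  have h := (ρ_pos he θ).ne'
  have hx : xt e θ = -Real.cos θ * (ρ e θ + 1) := by
    unfold xt
    field_simp
  rw [hx, ρ]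
  ring

theorem hasDerivAt_xt {e : ℝ} (he : |e| < 1) (θ : ℝ) : HasDerivAt (xt e) (2 * s e θ) θ := by
  rw [xt_eq he]
  have hc := Real.hasDerivAt_cos θ
  refine (hc.fun_neg.fun_mul ((hc.const_mul e).const_add 2)).congr_deriv ?_
  rw [s, ρ]
  ring

theorem hasDerivAt_s (e θ : ℝ) : HasDerivAt (s e) (s' e θ) θ := by
  have h := (((Real.hasDerivAt_cos θ).const_mul e).const_add 1).mul (Real.hasDerivAt_sin θ)
  refine h.congr_deriv ?_
  rw [s', Real.cos_two_mul']
  ring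

theorem hasDerivAt_s' (e θ : ℝ) :
    HasDerivAt (s' e) (-Real.sin θ - 2 * e * Real.sin (2 * θ)) θ := by
  have h := (Real.hasDerivAt_cos θ).add ((((hasDerivAt_id θ).const_mul 2).cos).const_mul e)
  refine h.congr_deriv ?_
  simp only [id]
  ring

/-- The second column of `Φ_θ` solves the in-plane Tschauner–Hempel system,
with derivatives `x̃′ = 2s` and `z̃′ = s′`. -/
theorem second_column_solves_TH (e : ℝ) (he : |e| < 1) :
    ∀ θ : ℝ,
      HasDerivAt (xt e) (2 * s e θ) θ ∧
      HasDerivAt (zt e) (s' e θ) θ ∧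
      HasDerivAt (deriv (xt e)) (2 * deriv (zt e) θ) θ ∧
      HasDerivAt (deriv (zt e)) (3 * zt e θ / ρ e θ - 2 * deriv (xt e) θ) θ := by
  have hx : deriv (xt e) = fun θ => 2 * s e θ := funext fun θ => (hasDerivAt_xt he θ).deriv
  have hz : deriv (zt e) = s' e := funext fun θ => (hasDerivAt_s e θ).deriv
  intro θ
  refine ⟨hasDerivAt_xt he θ, hasDerivAt_s e θ, ?_, ?_⟩
  · rw [hx, hz]
    exact (hasDerivAt_s e θ).const_mul 2
  · rw [hx, hz]
    refine (hasDerivAt_s' e θ).congr_deriv ?_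
    have hq : 3 * zt e θ / ρ e θ = 3 * Real.sin θ := by
      have h := (ρ_pos he θ).ne'
      unfold zt
      field_simp
    simp only [hq]
    rw [Real.sin_two_mul, s, ρ]
    ring
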